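/- arXiv:2201.07042 — 2 statements merged into one kernel-verified Lean document; each statement's English description precedes it below -/
import Mathlib

section
/- Let G be a finite group with conjugacy classes C₁,…,Cₙ, class algebra structure matrices M₁,…,Mₙ, and p_{ij} = Tr(MᵢMⱼ). Then the matrix (p_{ij})_{1≤i,j≤n} is invertible (over a field of characteristic zero). Consequently the center of the complex group algebra is semisimple. -/
open scoped Classical

/-- The class sum of the conjugacy class of `x` in the group algebra `ℂ[G]`. -/
noncomputable def classSum (G : Type*) [Group G] [Fintype G] (x : G) : MonoidAlgebra ℂ G :=
  ∑ g : G, if IsConj x g then MonoidAlgebra.single g (1 : ℂ) else 0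

theorem classSum_apply_aux (G : Type*) [Group G] [Fintype G] (x g : G) :
    (classSum G x).coeff g = if IsConj x g then (1 : ℂ) else 0 := by
  unfold classSum
  rw [MonoidAlgebra.coeff_sum, Finset.sum_apply', Finset.sum_eq_single g]
  · split_ifs <;> simp
  · intro b _ hb
    split_ifs <;> simp [hb]
  · simp

theorem center_apply_conj (G : Type*) [Group G] [Fintype G] (z : MonoidAlgebra ℂ G)
    (hz : z ∈ Subalgebra.center ℂ (MonoidAlgebra ℂ G)) {g h : G} (hgh : IsConj g h) :
    z.coeff g = z.coeff h := by
  obtain ⟨c, rfl⟩ := isConj_iff.1 hgh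
  have := Subalgebra.mem_center_iff.1 hz (MonoidAlgebra.single c 1)
  have := congrArg (fun f : MonoidAlgebra ℂ G => f.coeff (c * g)) this
  simpa [MonoidAlgebra.coeff_single_mul_apply, MonoidAlgebra.coeff_mul_single_apply] using this

theorem mem_center_of_conj (G : Type*) [Group G] [Fintype G] (z : MonoidAlgebra ℂ G)
    (hz : ∀ g h : G, IsConj g h → z.coeff g = z.coeff h) :
    z ∈ Subalgebra.center ℂ (MonoidAlgebra ℂ G) := by
  rw [Subalgebra.mem_center_iff]
  intro b
  induction b using MonoidAlgebra.induction_linear with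
  | zero => simp
  | add f g hf hg => rw [add_mul, mul_add, hf, hg]
  | single c r =>
    ext g
    rw [MonoidAlgebra.coeff_single_mul_apply, MonoidAlgebra.coeff_mul_single_apply, mul_comm]
    congr 1
    exact hz _ _ (isConj_iff.2 ⟨c, by simp [mul_assoc]⟩)

theorem center_reduced (G : Type*) [Group G] [Fintype G] :
    IsReduced (Subalgebra.center ℂ (MonoidAlgebra ℂ G)) := by
  have : NeZero (Nat.card G : ℂ) := ⟨by simp [Nat.card_eq_fintype_card]⟩
  have hss : IsSemisimpleRing (MonoidAlgebra ℂ G) := inferInstance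
  have hj : Ring.jacobson (MonoidAlgebra ℂ G) = ⊥ := IsSemisimpleModule.jacobson_eq_bot _ _
  refine ⟨fun z hz => ?_⟩
  have hmem : (z : MonoidAlgebra ℂ G) ∈ Ring.jacobson (MonoidAlgebra ℂ G) := by
    rw [← Ideal.jacobson_bot, Ideal.mem_jacobson_iff]
    intro y
    have hn : IsNilpotent (y * (z : MonoidAlgebra ℂ G)) := by
      have hc : Commute y (z : MonoidAlgebra ℂ G) := Subalgebra.mem_center_iff.1 z.2 y
      exact hc.isNilpotent_mul_left (hz.map (Subalgebra.center ℂ (MonoidAlgebra ℂ G)).val)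
    obtain ⟨u, hu⟩ := hn.isUnit_add_one
    refine ⟨(u⁻¹ : (MonoidAlgebra ℂ G)ˣ), ?_⟩
    have h1 : (↑u⁻¹ : MonoidAlgebra ℂ G) * (y * z + 1) = 1 := by rw [← hu]; simp
    rw [Ideal.mem_bot, mul_assoc, sub_eq_zero, ← h1, mul_add, mul_one]
  rw [hj] at hmem
  exact Subtype.ext (by simpa using hmem)

theorem trace_nondeg (A : Type*) [CommRing A] [Algebra ℂ A] [Module.Finite ℂ A] [IsReduced A]
    (z : A) (hz : ∀ w, Algebra.trace ℂ A (z * w) = 0) : z = 0 := by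
  have : IsArtinianRing A := IsArtinianRing.of_finite ℂ A
  have : IsSemisimpleRing A := IsArtinianRing.isSemisimpleRing_of_isReduced A
  obtain ⟨e, he, hI⟩ := IsSemisimpleRing.ideal_eq_span_idempotent (Ideal.span {z})
  have h1 : e ∈ Ideal.span {z} := hI ▸ Ideal.mem_span_singleton_self e
  obtain ⟨w, rfl⟩ := Ideal.mem_span_singleton'.1 h1
  have h2 := hz w
  rw [mul_comm] at h2
  have hid : IsIdempotentElem (Algebra.lmul ℂ A (w * z)) := he.map _
  rw [Algebra.trace_apply] at h2
  have hp := LinearMap.IsIdempotentElem.isProj_range _ hid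
  have h3 := hp.trace
  change LinearMap.trace ℂ A (Algebra.lmul ℂ A (w * z)) = 0 at h2
  rw [h2] at h3
  have h4 : Module.finrank ℂ (LinearMap.range (Algebra.lmul ℂ A (w * z))) = 0 := by
    exact_mod_cast h3.symm
  rw [Submodule.finrank_eq_zero, LinearMap.range_eq_bot] at h4
  have h5 : w * z = 0 := by simpa using LinearMap.congr_fun h4 1
  rw [h5] at hI
  simpa using hI

/-- the matrix `(p_{ij}) = (Tr(MᵢMⱼ))` of traces of the structure-constant
matrices of the class algebra is invertible; consequently the center of the complex group
algebra is semisimple (trivial Jacobson radical). -/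
theorem traceMatrix_invertible_and_center_semisimple
    (G : Type*) [Group G] [Fintype G] {n : ℕ} (x : Fin n → G)
    (hdist : ∀ i j, i ≠ j → ¬ IsConj (x i) (x j))
    (hexh : ∀ g : G, ∃ i, IsConj (x i) g)
    (a : Fin n → Fin n → Fin n → ℂ)
    (ha : ∀ i j, classSum G (x i) * classSum G (x j) =
      ∑ l : Fin n, a l i j • classSum G (x l))
    (M : Fin n → Matrix (Fin n) (Fin n) ℂ)
    (hM : ∀ j, M j = Matrix.of fun k l => a k l j) :
    IsUnit (Matrix.det (Matrix.of fun i j => Matrix.trace (M i * M j))) ∧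
      (⊥ : Ideal (Subalgebra.center ℂ (MonoidAlgebra ℂ G))).jacobson = ⊥ := by
  have := center_reduced G
  have : Module.Finite ℂ (MonoidAlgebra ℂ G) := inferInstance
  have : Module.Finite ℂ (Subalgebra.center ℂ (MonoidAlgebra ℂ G)) :=
    inferInstanceAs (Module.Finite ℂ (Subalgebra.toSubmodule (Subalgebra.center ℂ (MonoidAlgebra ℂ G))))
  have : IsArtinianRing (Subalgebra.center ℂ (MonoidAlgebra ℂ G)) := IsArtinianRing.of_finite ℂ _
  refine ⟨?_, ?_⟩
  swap
  · refine (IsArtinianRing.jacobson_eq_radical (R := Subalgebra.center ℂ (MonoidAlgebra ℂ G)) ⊥).trans ?_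
    exact nilradical_eq_zero _
  have hev : ∀ (v : Fin n → ℂ) (i : Fin n) (g : G), IsConj (x i) g →
      (∑ l, v l • classSum G (x l)).coeff g = v i := by
    intro v i g hg
    have h0 : (∑ l, v l • classSum G (x l)).coeff g = ∑ l, v l * (classSum G (x l)).coeff g := by
      simp [MonoidAlgebra.coeff_sum]
    rw [h0, Finset.sum_eq_single i]
    · rw [classSum_apply_aux, if_pos hg, mul_one]
    · intro j _ hj
      rw [classSum_apply_aux, if_neg, mul_zero]
      exact fun h => hdist j i hj (h.trans hg.symm)
    · simp
  have hcen : ∀ i, classSum G (x i) ∈ Subalgebra.center ℂ (MonoidAlgebra ℂ G) := by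
    intro i
    apply mem_center_of_conj
    intro g h hgh
    rw [classSum_apply_aux, classSum_apply_aux]
    congr 1
    exact propext ⟨fun h' => h'.trans hgh, fun h' => h'.trans hgh.symm⟩
  let c : Fin n → Subalgebra.center ℂ (MonoidAlgebra ℂ G) := fun i => ⟨classSum G (x i), hcen i⟩
  have hcoe : ∀ v : Fin n → ℂ, ((∑ l, v l • c l : Subalgebra.center ℂ (MonoidAlgebra ℂ G)) :
      MonoidAlgebra ℂ G) = ∑ l, v l • classSum G (x l) := by
    intro v
    simp [c]
  have hli : LinearIndependent ℂ c := by
    rw [Fintype.linearIndependent_iff]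
    intro v hv i
    rw [← hev v i (x i) (IsConj.refl _), ← hcoe, hv]
    rfl
  have hsp : ⊤ ≤ Submodule.span ℂ (Set.range c) := by
    rintro z -
    have : z = ∑ l, ((z : MonoidAlgebra ℂ G).coeff (x l)) • c l := by
      apply Subtype.ext
      rw [hcoe]
      ext g
      obtain ⟨i, hi⟩ := hexh g
      exact (center_apply_conj G _ z.2 hi).symm.trans
        (hev (fun l => (z : MonoidAlgebra ℂ G).coeff (x l)) i g hi).symm
    rw [this]
    exact Submodule.sum_mem _ fun i _ =>
      Submodule.smul_mem _ _ (Submodule.subset_span (Set.mem_range_self i))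
  let b := Module.Basis.mk hli hsp
  have hb : ∀ i, b i = c i := fun i => Module.Basis.mk_apply hli hsp i
  have hMb : ∀ j, M j = Algebra.leftMulMatrix b (b j) := by
    intro j
    ext k l
    have hprod : b j * b l = ∑ k, a k l j • b k := by
      rw [mul_comm]
      simp only [hb]
      apply Subtype.ext
      rw [hcoe (fun k => a k l j)]
      exact ha l j
    rw [hM, Algebra.leftMulMatrix_eq_repr_mul, hprod]
    simp [Finsupp.single_apply]
  have hP : ∀ i j, Matrix.trace (M i * M j) = Algebra.trace ℂ _ (b i * b j) := by
    intro i j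
    rw [hMb, hMb, ← map_mul, Algebra.trace_eq_matrix_trace b]
  rw [isUnit_iff_ne_zero]
  intro hdet
  obtain ⟨v, hv0, hv⟩ := Matrix.exists_mulVec_eq_zero_iff.2 hdet
  apply hv0
  have hz : ∑ j, v j • b j = 0 := by
    apply trace_nondeg
    intro w
    rw [← b.sum_repr w, Finset.mul_sum, map_sum]
    refine Finset.sum_eq_zero fun i _ => ?_
    rw [mul_smul_comm, map_smul]
    have hi := congrFun hv i
    simp only [Matrix.mulVec, dotProduct, Matrix.of_apply, hP, Pi.zero_apply] at hi
    have : Algebra.trace ℂ _ ((∑ j, v j • b j) * b i) = 0 := by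
      rw [← hi, Finset.sum_mul, map_sum]
      refine Finset.sum_congr rfl fun j _ => ?_
      rw [smul_mul_assoc, map_smul, smul_eq_mul, mul_comm, mul_comm (b j)]
    rw [this, smul_zero]
  funext i
  exact Fintype.linearIndependent_iff.1 b.linearIndependent v hz i
end

section
/- Let G be a finite group of order ℓ, and g an element in conjugacy class Cᵢ of size ℓᵢ. Then the number of pairs (r,s) ∈ G×G with s⁻¹r⁻¹sr = g equals ∑_{j=1}^{n} ℓ·ℓ_{i j j'}/(ℓᵢ·ℓⱼ), where ℓ_{ijj'} = #{(a,b,c) ∈ Cᵢ×Cⱼ×C_{j'} : abc = 1}. Equivalently, by Frobenius' formula, this number equals ∑_{χ ∈ Irr(G)} ℓ·χ(g)/χ(1). -/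
/-- `ellCount G x` is the number of tuples `(g₁,…,g_r)` with `g_j` in the conjugacy class of
`x j` and `g₁ ⋯ g_r = 1`. -/
noncomputable def ellCount (G : Type) [Group G] {r : ℕ} (x : Fin r → G) : ℕ :=
  Nat.card {g : Fin r → G // (∀ j, IsConj (x j) (g j)) ∧ (List.ofFn g).prod = 1}

open Classical in
lemma cc_card_eq_sum {α : Type*} [Fintype α] (p : α → Prop) :
    (Nat.card {a // p a} : ℂ) = ∑ a, if p a then (1 : ℂ) else 0 := by
  rw [Nat.card_eq_fintype_card, Fintype.card_subtype]
  simp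

open Classical in
lemma cc_sum_split {G : Type} [Group G] [Fintype G] {n : ℕ} (x : Fin n → G)
    (hdist : ∀ i j, i ≠ j → ¬ IsConj (x i) (x j))
    (hexh : ∀ g : G, ∃ i, IsConj (x i) g) (F : G → ℂ) :
    ∑ g, F g = ∑ j, ∑ g, if IsConj (x j) g then F g else 0 := by
  rw [Finset.sum_comm]
  refine Finset.sum_congr rfl fun g _ => ?_
  obtain ⟨i, hi⟩ := hexh g
  rw [Finset.sum_eq_single i]
  · simp [hi, -isConj_iff]
  · intro j _ hj
    rw [if_neg]
    intro h
    exact hdist j i hj (h.trans hi.symm)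
  · simp

open Classical in
lemma cc_sum_conj {G : Type} [Group G] [Fintype G] (F : G → ℂ)
    (hF : ∀ g h, IsConj g h → F g = F h) (a : G) :
    (∑ g, if IsConj a g then F g else 0) = (Nat.card {y : G // IsConj a y} : ℂ) * F a := by
  rw [cc_card_eq_sum, Finset.sum_mul]
  refine Finset.sum_congr rfl fun g _ => ?_
  split_ifs with h
  · rw [hF a g h, one_mul]
  · simp

lemma cc_sum_class {G : Type} [Group G] [Fintype G] {n : ℕ} (x : Fin n → G)
    (hdist : ∀ i j, i ≠ j → ¬ IsConj (x i) (x j))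
    (hexh : ∀ g : G, ∃ i, IsConj (x i) g) (F : G → ℂ)
    (hF : ∀ g h, IsConj g h → F g = F h) :
    ∑ g, F g = ∑ j, (Nat.card {y : G // IsConj (x j) y} : ℂ) * F (x j) := by
  rw [cc_sum_split x hdist hexh]
  exact Finset.sum_congr rfl fun j _ => cc_sum_conj F hF _

lemma cc_card_ne {G : Type} [Group G] [Fintype G] (a : G) :
    (Nat.card {y : G // IsConj a y} : ℂ) ≠ 0 := by
  have : Nonempty {y : G // IsConj a y} := ⟨⟨a, IsConj.refl a⟩⟩
  exact_mod_cast Nat.card_pos.ne'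

open Classical in
/-- number of conjugators from `b` to `c` -/
lemma cc_conjugators {G : Type} [Group G] [Fintype G] (b c : G) :
    (∑ s : G, if s⁻¹ * b * s = c then (1 : ℂ) else 0) =
      if IsConj b c then (Fintype.card G : ℂ) / (Nat.card {y : G // IsConj b y} : ℂ) else 0 := by
  split_ifs with h
  · rw [eq_div_iff (cc_card_ne b)]
    have key : ∀ d, IsConj b d → (∑ s : G, if s⁻¹ * b * s = d then (1 : ℂ) else 0) =
        ∑ s : G, if s⁻¹ * b * s = c then (1 : ℂ) else 0 := by
      intro d hd
      obtain ⟨t, ht⟩ := isConj_iff.1 (h.symm.trans hd)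
      refine Fintype.sum_equiv (Equiv.mulRight t) _ _ fun s => ?_
      refine if_congr ?_ rfl rfl
      subst ht
      simp only [Equiv.coe_mulRight, mul_inv_rev]
      constructor
      · intro e
        calc t⁻¹ * s⁻¹ * b * (s * t) = t⁻¹ * (s⁻¹ * b * s) * t := by group
          _ = c := by rw [e]; group
      · intro e
        rw [← e]; group
    have h2 : (∑ d : G, if IsConj b d then
        (∑ s : G, if s⁻¹ * b * s = d then (1 : ℂ) else 0) else 0) = Fintype.card G := by
      have : ∀ d : G, (if IsConj b d then
        (∑ s : G, if s⁻¹ * b * s = d then (1 : ℂ) else 0) else 0) =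
          ∑ s : G, if s⁻¹ * b * s = d then (1 : ℂ) else 0 := by
        intro d
        split_ifs with hd
        · rfl
        · symm
          refine Finset.sum_eq_zero fun s _ => if_neg fun e => hd ?_
          exact isConj_iff.2 ⟨s⁻¹, by simpa using e⟩
      simp_rw [this]
      rw [Finset.sum_comm]
      simp
    rw [← h2, cc_card_eq_sum, Finset.mul_sum]
    refine Finset.sum_congr rfl fun d _ => ?_
    split_ifs with hd
    · rw [key d hd, mul_one]
    · simp
  · refine Finset.sum_eq_zero fun s _ => if_neg fun e => h ?_
    exact isConj_iff.2 ⟨s⁻¹, by simpa using e⟩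

open Classical in
lemma cc_count {G : Type} [Group G] [Fintype G] (g : G) :
    (Nat.card {p : G × G // p.2⁻¹ * p.1⁻¹ * p.2 * p.1 = g} : ℂ) =
      ∑ b : G, ∑ s : G, if s⁻¹ * b * s = g * b then (1 : ℂ) else 0 := by
  rw [cc_card_eq_sum, Fintype.sum_prod_type]
  refine Fintype.sum_equiv (Equiv.inv G) _ _ fun r => Finset.sum_congr rfl fun s _ => ?_
  refine if_congr ?_ rfl rfl
  simp only [Equiv.inv_apply]
  rw [eq_mul_inv_iff_mul_eq]

open Classical in
lemma cc_ell {G : Type} [Group G] [Fintype G] (g y : G) :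
    (ellCount G ![g, y, y⁻¹] : ℂ) = ∑ a : G, if IsConj g a then
      (∑ b : G, if IsConj y b ∧ IsConj y (a * b) then (1 : ℂ) else 0) else 0 := by
  have e : ellCount G ![g, y, y⁻¹] =
      Nat.card {p : G × G // IsConj g p.1 ∧ IsConj y p.2 ∧ IsConj y (p.1 * p.2)} := by
    have hinv : ∀ u v : G, IsConj u v → IsConj u⁻¹ v⁻¹ := by
      intro u v h
      obtain ⟨t, ht⟩ := isConj_iff.1 h
      exact isConj_iff.2 ⟨t, by rw [← ht]; group⟩
    unfold ellCount
    refine Nat.card_congr ⟨fun f => ⟨(f.1 0, f.1 1), ?_⟩,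
      fun p => ⟨![p.1.1, p.1.2, (p.1.1 * p.1.2)⁻¹], ?_⟩, ?_, ?_⟩
    · obtain ⟨f, h, h1⟩ := f
      have h0 := h 0
      have h1' := h 1
      have h2 := h 2
      simp [List.ofFn_succ, -isConj_iff] at h0 h1' h2 h1
      refine ⟨h0, h1', ?_⟩
      have := hinv _ _ h2
      rw [inv_inv] at this
      convert this using 1
      rw [eq_inv_iff_mul_eq_one, mul_assoc]; exact h1
    · obtain ⟨⟨a, b⟩, h0, h1, h2⟩ := p
      refine ⟨?_, ?_⟩
      · intro j
        fin_cases j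
        · exact h0
        · exact h1
        · exact hinv _ _ h2
      · simp [List.ofFn_succ, ← mul_assoc]
    · rintro ⟨f, h, h1⟩
      simp [List.ofFn_succ] at h1
      apply Subtype.ext
      funext j
      fin_cases j
      · rfl
      · rfl
      · change (f 0 * f 1)⁻¹ = f 2
        rw [inv_eq_iff_mul_eq_one, mul_assoc]; exact h1
    · rintro ⟨⟨a, b⟩, h⟩
      rfl
  rw [e, cc_card_eq_sum, Fintype.sum_prod_type]
  refine Finset.sum_congr rfl fun a _ => ?_
  by_cases h : IsConj g a <;> simp [h, -isConj_iff]

open Classical in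
lemma cc_ell' {G : Type} [Group G] [Fintype G] (g y : G) :
    (ellCount G ![g, y, y⁻¹] : ℂ) = (Nat.card {a : G // IsConj g a} : ℂ) *
      (∑ b : G, if IsConj y b ∧ IsConj y (g * b) then (1 : ℂ) else 0) := by
  rw [cc_ell, cc_sum_conj (fun a => ∑ b : G, if IsConj y b ∧ IsConj y (a * b) then (1 : ℂ) else 0)]
  intro a c h
  obtain ⟨t, rfl⟩ := isConj_iff.1 h
  refine Fintype.sum_equiv (MulAut.conj t).toEquiv _ _ fun b => ?_
  have h1 : ∀ z, IsConj y (t * z * t⁻¹) ↔ IsConj y z := fun z =>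
    ⟨fun h => h.trans (isConj_iff.2 ⟨t, rfl⟩).symm, fun h => h.trans (isConj_iff.2 ⟨t, rfl⟩)⟩
  refine if_congr ?_ rfl rfl
  simp only [MulEquiv.toEquiv_eq_coe, EquivLike.coe_coe, MulAut.conj_apply]
  rw [h1, show t * a * t⁻¹ * (t * b * t⁻¹) = t * (a * b) * t⁻¹ by group, h1]

lemma cc_isConj_card {G : Type} [Group G] {a b : G} (h : IsConj a b) :
    Nat.card {y : G // IsConj a y} = Nat.card {y : G // IsConj b y} :=
  Nat.card_congr (Equiv.subtypeEquivRight fun _ => ⟨fun h' => h.symm.trans h', fun h' => h.trans h'⟩)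

lemma cc_part1 {G : Type} [Group G] [Fintype G]
    {n : ℕ} (x : Fin n → G)
    (hdist : ∀ i j, i ≠ j → ¬ IsConj (x i) (x j))
    (hexh : ∀ g : G, ∃ i, IsConj (x i) g) (g : G) :
    (Nat.card {p : G × G // p.2⁻¹ * p.1⁻¹ * p.2 * p.1 = g} : ℂ) =
      ∑ j : Fin n, (Fintype.card G : ℂ) * (ellCount G ![g, x j, (x j)⁻¹] : ℂ) /
        ((Nat.card {y : G // IsConj g y} : ℂ) *
          (Nat.card {y : G // IsConj (x j) y} : ℂ)) := by
  classical
  rw [cc_count, cc_sum_split x hdist hexh]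
  refine Finset.sum_congr rfl fun j _ => ?_
  have hg := cc_card_ne g
  have hj := cc_card_ne (x j)
  rw [cc_ell', mul_left_comm, mul_div_mul_left _ _ hg, Finset.mul_sum, Finset.sum_div]
  refine Finset.sum_congr rfl fun b _ => ?_
  rw [cc_conjugators]
  by_cases h : IsConj (x j) b
  · have : IsConj b (g * b) ↔ IsConj (x j) (g * b) :=
      ⟨fun h' => h.trans h', fun h' => h.symm.trans h'⟩
    simp only [h, true_and, if_true, this, cc_isConj_card h]
    split_ifs <;> simp
  · simp [h, -isConj_iff]

/-- Schur: averaged conjugate is scalar. -/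
lemma cc_schur {G : Type} [Group G] [Fintype G] (V : FDRep ℂ G) [CategoryTheory.Simple V] :
    V.character 1 ≠ 0 ∧ ∀ s t : G,
      ∑ r : G, V.character (r⁻¹ * s * r * t) =
        Fintype.card G * V.character s * V.character t / V.character 1 := by
  have hr : Module.finrank ℂ (V ⟶ V) = 1 :=
    CategoryTheory.finrank_endomorphism_simple_eq_one ℂ V
  rw [← LinearEquiv.finrank_eq (Representation.linHom.invariantsEquivFDRepHom V V)] at hr
  have hV : V.character 1 ≠ 0 := by
    rw [FDRep.char_one]
    intro h0
    have h0 : Module.finrank ℂ V = 0 := by exact_mod_cast h0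
    have : Subsingleton V := Module.finrank_zero_iff.1 h0
    have h2 : Subsingleton (Representation.linHom V.ρ V.ρ).invariants := inferInstance
    have := Module.finrank_zero_of_subsingleton (R := ℂ)
      (M := (Representation.linHom V.ρ V.ρ).invariants)
    omega
  refine ⟨hV, fun s t => ?_⟩
  have hnt : Nontrivial V := by
    by_contra h
    rw [not_nontrivial_iff_subsingleton] at h
    exact hV (by rw [FDRep.char_one, Module.finrank_zero_of_subsingleton]; simp)
  let T : V →ₗ[ℂ] V := ∑ r : G, V.ρ (r⁻¹ * s * r)
  have hT : T ∈ (Representation.linHom V.ρ V.ρ).invariants := by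
    intro u
    rw [Representation.linHom_apply]
    change V.ρ u * (T * V.ρ u⁻¹) = T
    simp only [T, Finset.sum_mul, Finset.mul_sum, ← map_mul]
    refine Fintype.sum_equiv (Equiv.mulRight u⁻¹) _ _ fun r => ?_
    congr 1
    simp only [Equiv.coe_mulRight]
    group
  have hI : (1 : V →ₗ[ℂ] V) ∈ (Representation.linHom V.ρ V.ρ).invariants := by
    intro u
    rw [Representation.linHom_apply]
    change V.ρ u * (1 * V.ρ u⁻¹) = 1
    rw [one_mul, ← map_mul]
    simp
  obtain ⟨c, hc⟩ := (finrank_eq_one_iff_of_nonzero'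
    (⟨1, hI⟩ : (Representation.linHom V.ρ V.ρ).invariants) (by
      intro h
      exact one_ne_zero (congrArg Subtype.val h))).1 hr ⟨T, hT⟩
  have hc : c • (1 : V →ₗ[ℂ] V) = T := congrArg Subtype.val hc
  have key : ∀ t, ∑ r : G, V.character (r⁻¹ * s * r * t) = c * V.character t := by
    intro t
    have h1 : LinearMap.trace ℂ V (T * V.ρ t) = c * V.character t := by
      rw [← hc, smul_mul_assoc, one_mul, map_smul, smul_eq_mul]; rfl
    rw [← h1]
    simp only [T, Finset.sum_mul, ← map_mul, map_sum]
    rfl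
  have k1 := key 1
  have : ∀ r : G, V.character (r⁻¹ * s * r * 1) = V.character s := by
    intro r
    have := V.char_conj s r⁻¹
    simpa using this
  simp only [this] at k1
  simp at k1
  rw [key, eq_div_iff hV, FDRep.char_one, k1]
  ring

lemma cc_char_conj {G : Type} [Group G] (V : FDRep ℂ G) {a b : G} (h : IsConj a b) :
    V.character a = V.character b := by
  obtain ⟨t, rfl⟩ := isConj_iff.1 h
  rw [FDRep.char_conj]

lemma cc_char_conj_inv {G : Type} [Group G] (V : FDRep ℂ G) {a b : G} (h : IsConj a b) :
    V.character a⁻¹ = V.character b⁻¹ := by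
  obtain ⟨t, rfl⟩ := isConj_iff.1 h
  rw [show (t * a * t⁻¹)⁻¹ = t * a⁻¹ * t⁻¹ by group, FDRep.char_conj]

lemma cc_inner {G : Type} [Group G] [Fintype G] (V : FDRep ℂ G) [CategoryTheory.Simple V] :
    ∑ g : G, (Nat.card {p : G × G // p.2⁻¹ * p.1⁻¹ * p.2 * p.1 = g} : ℂ) * V.character g⁻¹ =
      (Fintype.card G : ℂ) ^ 2 / V.character 1 := by
  classical
  obtain ⟨hV, hs⟩ := cc_schur V
  simp_rw [cc_card_eq_sum, Finset.sum_mul]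
  rw [Finset.sum_comm]
  simp only [ite_mul, one_mul, zero_mul, Finset.sum_ite_eq, Finset.mem_univ, if_true]
  rw [Fintype.sum_prod_type, Finset.sum_comm]
  have : ∀ s r : G, V.character (s⁻¹ * r⁻¹ * s * r)⁻¹ = V.character (r⁻¹ * s⁻¹ * r * s) := by
    intro s r
    congr 1
    group
  simp only [this, hs]
  have := (FDRep.simple_iff_char_is_norm_one V).1 inferInstance
  rw [← Finset.sum_div]
  congr 1
  simp only [mul_assoc]
  rw [← Finset.mul_sum]
  simp only [mul_comm (V.character _⁻¹)]
  rw [this, Nat.card_eq_fintype_card, sq]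

lemma cc_part2 {G : Type} [Group G] [Fintype G]
    {n : ℕ} (x : Fin n → G)
    (hdist : ∀ i j, i ≠ j → ¬ IsConj (x i) (x j))
    (hexh : ∀ g : G, ∃ i, IsConj (x i) g)
    (V : Fin n → FDRep ℂ G)
    (hsimple : ∀ l, CategoryTheory.Simple (V l))
    (hnoniso : ∀ l m, l ≠ m → ¬ Nonempty (V l ≅ V m)) (f : G → ℂ)
    (hf : ∀ g h, IsConj g h → f g = f h) (g : G) :
    f g = ∑ l, ((Fintype.card G : ℂ)⁻¹ * ∑ h, f h * (V l).character h⁻¹) * (V l).character g := by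
  classical
  let X : Matrix (Fin n) (Fin n) ℂ := fun l j => (V l).character (x j)
  let Y : Matrix (Fin n) (Fin n) ℂ := fun j m =>
    (Fintype.card G : ℂ)⁻¹ * ((Nat.card {y : G // IsConj (x j) y} : ℂ) * (V m).character (x j)⁻¹)
  have hcl : ∀ m (F : G → ℂ), (∀ g h, IsConj g h → F g = F h) →
      (Fintype.card G : ℂ)⁻¹ * ∑ h, F h * (V m).character h⁻¹ = ∑ j, F (x j) * Y j m := by
    intro m F hF
    rw [cc_sum_class x hdist hexh (fun h => F h * (V m).character h⁻¹)
      (fun a b h => by rw [hF a b h, cc_char_conj_inv _ h]), Finset.mul_sum]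
    refine Finset.sum_congr rfl fun j _ => ?_
    simp only [Y]
    ring
  have hXY : X * Y = 1 := by
    ext l m
    rw [Matrix.mul_apply]
    have := hsimple l
    have := hsimple m
    have : Invertible (Nat.card G : ℂ) := invertibleOfNonzero (by
      exact_mod_cast Nat.card_pos.ne')
    have h := FDRep.char_orthonormal (V l) (V m)
    rw [Nat.card_eq_fintype_card, hcl m (V l).character (fun a b h => cc_char_conj _ h)] at h
    rw [h, Matrix.one_apply]
    by_cases hlm : l = m
    · subst hlm
      rw [if_pos ⟨CategoryTheory.Iso.refl _⟩, if_pos rfl]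
    · rw [if_neg (hnoniso l m hlm), if_neg hlm]
  have hYX : Y * X = 1 := mul_eq_one_comm.1 hXY
  obtain ⟨k, hk⟩ := hexh g
  rw [← hf _ _ hk]
  simp only [hcl _ f hf, Finset.sum_mul]
  rw [Finset.sum_comm]
  have : ∀ j, ∑ l, f (x j) * Y j l * (V l).character g = f (x j) * (Y * X) j k := by
    intro j
    rw [Matrix.mul_apply, Finset.mul_sum]
    refine Finset.sum_congr rfl fun l _ => ?_
    rw [mul_assoc, ← cc_char_conj _ hk]
  simp only [this, hYX, Matrix.one_apply]
  simp

lemma cc_count_class {G : Type} [Group G] [Fintype G] (g h : G) (hgh : IsConj g h) :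
    (Nat.card {p : G × G // p.2⁻¹ * p.1⁻¹ * p.2 * p.1 = g} : ℂ) =
      (Nat.card {p : G × G // p.2⁻¹ * p.1⁻¹ * p.2 * p.1 = h} : ℂ) := by
  obtain ⟨t, rfl⟩ := isConj_iff.1 hgh
  congr 1
  refine Nat.card_congr (Equiv.subtypeEquiv
    ((MulAut.conj t).toEquiv.prodCongr (MulAut.conj t).toEquiv) fun p => ?_)
  simp only [Equiv.prodCongr_apply, Prod.map, MulEquiv.toEquiv_eq_coe, EquivLike.coe_coe,
    ← map_inv, ← map_mul]
  rw [← MulAut.conj_apply, (MulAut.conj t).injective.eq_iff]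

/-- the number of pairs `(r,s)` with `s⁻¹r⁻¹sr = g` equals
`∑_j |G|·ℓ_{ijj'}/(ℓᵢℓⱼ)` (where `g ∈ Cᵢ`), and also equals `∑_χ |G|·χ(g)/χ(1)`. -/
theorem commutator_count (G : Type) [Group G] [Fintype G]
    {n : ℕ} (x : Fin n → G)
    (hdist : ∀ i j, i ≠ j → ¬ IsConj (x i) (x j))
    (hexh : ∀ g : G, ∃ i, IsConj (x i) g)
    (V : Fin n → FDRep ℂ G)
    (hsimple : ∀ l, CategoryTheory.Simple (V l))
    (hnoniso : ∀ l m, l ≠ m → ¬ Nonempty (V l ≅ V m))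
    (hcomplete : ∀ W : FDRep ℂ G, CategoryTheory.Simple W → ∃ l, Nonempty (W ≅ V l))
    (g : G) :
    ((Nat.card {p : G × G // p.2⁻¹ * p.1⁻¹ * p.2 * p.1 = g} : ℂ) =
      ∑ j : Fin n, (Fintype.card G : ℂ) * (ellCount G ![g, x j, (x j)⁻¹] : ℂ) /
        ((Nat.card {y : G // IsConj g y} : ℂ) *
          (Nat.card {y : G // IsConj (x j) y} : ℂ))) ∧
    ((Nat.card {p : G × G // p.2⁻¹ * p.1⁻¹ * p.2 * p.1 = g} : ℂ) =
      ∑ l : Fin n, (Fintype.card G : ℂ) * (V l).character g / (V l).character 1) := by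
  refine ⟨cc_part1 x hdist hexh g, ?_⟩
  rw [cc_part2 x hdist hexh V hsimple hnoniso
    (fun g => (Nat.card {p : G × G // p.2⁻¹ * p.1⁻¹ * p.2 * p.1 = g} : ℂ)) cc_count_class g]
  refine Finset.sum_congr rfl fun l _ => ?_
  have := hsimple l
  rw [cc_inner (V l)]
  have h0 : (Fintype.card G : ℂ) ≠ 0 := by exact_mod_cast Fintype.card_ne_zero
  field_simp
end
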